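/- arXiv:2511.10883 — 16 statements merged into one kernel-verified Lean document; each statement's English description precedes it below -/
import Mathlib

section
/- Johnson's third axiom is redundant: if a type B equipped with a binary operation ∧ and a unary operation ' satisfies (J1) x ∧ y = y ∧ x, (J2) (x ∧ y) ∧ z = x ∧ (y ∧ z), (J4) x'' = x, and (J5) x' = (x ∧ y)' ∧ (x ∧ y')' for all x, y, z ∈ B, then the idempotent law x ∧ x = x holds for all x ∈ B. -/
/-- Johnson's third axiom (idempotence) is redundant: it follows from
(J1), (J2), (J4), (J5). -/
theorem johnson_J3_redundant {B : Type*} (m : B → B → B) (c : B → B)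
    (J1 : ∀ x y, m x y = m y x)
    (J2 : ∀ x y z, m (m x y) z = m x (m y z))
    (J4 : ∀ x, c (c x) = x)
    (J5 : ∀ x y, c x = m (c (m x y)) (c (m x (c y)))) :
    ∀ x, m x x = x := by
  have left_comm : ∀ x y z, m x (m y z) = m y (m x z) := fun x y z => by
    rw [← J2, J1 x y, J2]
  have huntington : ∀ x y, x = m (c (m (c x) y)) (c (m (c x) (c y))) := fun x y => by
    rw [← J5, J4]
  -- `m x (c x)` does not depend on `x`
  have const : ∀ x y, m x (c x) = m y (c y) := fun x y => by
    calc m x (c x)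
        = m (m (c (m (c x) y)) (c (m (c x) (c y)))) (m (c (m x y)) (c (m x (c y)))) := by
          rw [← huntington, ← J5]
      _ = m (m (c (m (c y) x)) (c (m (c y) (c x)))) (m (c (m y x)) (c (m y (c x)))) := by
          have : Std.Associative m := ⟨J2⟩
          have : Std.Commutative m := ⟨J1⟩
          rw [J1 (c y) x, J1 (c y) (c x), J1 y x, J1 y (c x)]
          ac_rfl
      _ = m y (c y) := by rw [← huntington, ← J5]
  intro a
  obtain ⟨e, he⟩ : ∃ e, e = m a (c a) := ⟨_, rfl⟩
  have compl : ∀ x, m x (c x) = e := fun x => (const x a).trans he.symm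
  have e_zero : m e (c e) = e := compl e
  have absorb : c e = m (c e) (c (m e e)) := by
    have h := J5 e (c e)
    rwa [J4, e_zero] at h
  have e_idem : m e e = e := by
    calc m e e = m (m e (c e)) e := by rw [e_zero]
      _ = m (m e e) (m (c e) (c (m e e))) := by rw [← absorb, J2, J1 (c e) e, J2]
      _ = m (c e) (m (m e e) (c (m e e))) := left_comm _ _ _
      _ = e := by rw [compl, J1, e_zero]
  have zero_idem : m (c e) (c e) = c e := by
    have h := absorb
    rw [e_idem] at h
    exact h.symm
  have decomp : ∀ x, c x = m (c (m x x)) (c e) := fun x => by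
    rw [← compl x, ← J5]
  have compl_zero : ∀ x, m (c x) (c e) = c x := fun x => by
    rw [decomp x, J2, zero_idem]
  have h : c a = c (m a a) := (decomp a).trans (compl_zero (m a a))
  rw [← J4 (m a a), ← h, J4]
end

section
/- The identities (J1), (J2), (J4), (J5) form a base for Boolean algebras: if a type B equipped with a binary operation ∧ and a unary operation ' satisfies (J1) x ∧ y = y ∧ x, (J2) (x ∧ y) ∧ z = x ∧ (y ∧ z), (J4) x'' = x, and (J5) x' = (x ∧ y)' ∧ (x ∧ y')' for all x, y, z ∈ B, and B is nonempty, then there exists a Boolean algebra structure on B whose infimum operation is ∧ and whose complement operation is '. -/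
namespace JohnsonBase

variable {B : Type*} {m : B → B → B} {c : B → B}

theorem inf_compl_eq (J1 : ∀ x y, m x y = m y x)
    (J2 : ∀ x y z, m (m x y) z = m x (m y z)) (J4 : ∀ x, c (c x) = x)
    (J5 : ∀ x y, c x = m (c (m x y)) (c (m x (c y)))) (x y : B) :
    m x (c x) = m y (c y) := by
  have expand : ∀ u v, u = m (c (m (c u) v)) (c (m (c u) (c v))) := fun u v => by
    rw [← J5, J4]
  have : Std.Commutative m := ⟨J1⟩
  have : Std.Associative m := ⟨J2⟩
  calc m x (c x) = m (m (c (m (c x) y)) (c (m (c x) (c y))))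
        (m (c (m x y)) (c (m x (c y)))) := by rw [← expand, ← J5]
    _ = m (m (c (m (c y) x)) (c (m (c y) (c x))))
        (m (c (m y x)) (c (m y (c x)))) := by
      rw [J1 (c y) x, J1 (c y) (c x), J1 y x, J1 y (c x)]
      ac_rfl
    _ = m y (c y) := by rw [← expand, ← J5]

theorem inf_compl_bot_eq_and_inf_self (J1 : ∀ x y, m x y = m y x)
    (J2 : ∀ x y z, m (m x y) z = m x (m y z)) (J4 : ∀ x, c (c x) = x)
    (J5 : ∀ x y, c x = m (c (m x y)) (c (m x (c y)))) {o : B} (ho : ∀ x, m x (c x) = o)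
    (x : B) : m x (c o) = x ∧ m x x = x := by
  have double : ∀ u, m (c (m (c u) (c u))) (c o) = u := fun u => by
    have h := J5 (c u) (c u)
    rwa [J4, J1 (c u) u, ho, eq_comm] at h
  have bot_inf : m o o = o := by
    have h₁ : m (c (m o o)) (c o) = c o := by simpa only [J4] using double (c o)
    have h₂ : m o (c (m o o)) = o := by
      calc m o (c (m o o)) = m (m o (c o)) (c (m o o)) := by rw [ho]
        _ = m o (m (c (m o o)) (c o)) := by rw [J2, J1 (c o)]
        _ = o := by rw [h₁, ho]
    calc m o o = m o (m o (c (m o o))) := by rw [h₂]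
      _ = o := by rw [← J2, ho]
  have top_inf : m (c o) (c o) = c o := by
    simpa only [J4, bot_inf] using double (c o)
  have inf_top : ∀ u, m u (c o) = u := fun u => by
    rw [← double u, J2, top_inf]
  refine ⟨inf_top x, ?_⟩
  have h := double (c x)
  rw [inf_top, J4] at h
  rw [← J4 (m x x), h, J4]

end JohnsonBase

/-- (J1), (J2), (J4), (J5) form a base for Boolean algebras. -/
theorem johnson_four_base {B : Type*} [Nonempty B] (m : B → B → B) (c : B → B)
    (J1 : ∀ x y, m x y = m y x)
    (J2 : ∀ x y z, m (m x y) z = m x (m y z))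
    (J4 : ∀ x, c (c x) = x)
    (J5 : ∀ x y, c x = m (c (m x y)) (c (m x (c y)))) :
    ∃ ba : BooleanAlgebra B, ba.inf = m ∧ ba.compl = c := by
  obtain ⟨e⟩ := ‹Nonempty B›
  obtain ⟨o, ho⟩ : ∃ o, ∀ x, m x (c x) = o :=
    ⟨m e (c e), fun x => JohnsonBase.inf_compl_eq J1 J2 J4 J5 x e⟩
  have inf_top x : m x (c o) = x :=
    (JohnsonBase.inf_compl_bot_eq_and_inf_self J1 J2 J4 J5 ho x).1
  have inf_idem x : m x x = x :=
    (JohnsonBase.inf_compl_bot_eq_and_inf_self J1 J2 J4 J5 ho x).2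
  have inf_bot x : m x o = o := by rw [← ho x, ← J2, inf_idem]
  have le_iff a b : m a b = a ↔ m a (c b) = o := by
    constructor
    · intro h
      rw [← h, J2, ho, inf_bot]
    · intro h
      have h' := J5 a b
      rw [h, inf_top] at h'
      rw [← J4 (m a b), ← h', J4]
  have trans a b d (h₁ : m a b = a) (h₂ : m b d = b) : m a d = a := by
    rw [← h₁, J2, h₂]
  have inf_left a b : m (m a b) a = m a b := by rw [J1 (m a b), ← J2, inf_idem]
  have inf_right a b : m (m a b) b = m a b := by rw [J2, inf_idem]
  have le_inf a b d (h₁ : m a b = a) (h₂ : m a d = a) : m a (m b d) = a := by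
    rw [← J2, h₁, h₂]
  have compl_anti a b (h : m a b = a) : m (c b) (c a) = c b := by
    rw [le_iff, J4, J1]
    exact (le_iff a b).1 h
  have le_sup_left a b : m a (c (m (c a) (c b))) = a := by
    simpa only [J4] using compl_anti _ _ (inf_left (c a) (c b))
  have sup_comm a b : c (m (c a) (c b)) = c (m (c b) (c a)) := by rw [J1]
  have residual a x y (h : m a (c (m (c x) (c y))) = a) : m (m a (c x)) y = m a (c x) := by
    rw [le_iff, J2]
    simpa only [J4] using (le_iff _ _).1 h
  let ba : BooleanAlgebra B :=
    { le := fun a b => m a b = a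
      le_refl := inf_idem
      le_trans := trans
      le_antisymm := fun a b h₁ h₂ => by
        change m a b = a at h₁
        change m b a = b at h₂
        rw [← h₁, J1, h₂]
      inf := m
      inf_le_left := inf_left
      inf_le_right := inf_right
      le_inf := le_inf
      sup := fun a b => c (m (c a) (c b))
      le_sup_left := le_sup_left
      le_sup_right := fun a b => by
        rw [sup_comm, le_sup_left]
      sup_le := fun a b d h₁ h₂ => by
        simpa only [J4] using
          compl_anti _ _ (le_inf _ _ _ (compl_anti _ _ h₁) (compl_anti _ _ h₂))
      le_sup_inf := fun x y z => by
        change m (m (c (m (c x) (c y))) (c (m (c x) (c z)))) (c (m (c x) (c (m y z)))) =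
          m (c (m (c x) (c y))) (c (m (c x) (c z)))
        rw [le_iff, J4, ← J2, ← le_iff]
        exact le_inf _ _ _ (residual _ _ _ (inf_left _ _)) (residual _ _ _ (inf_right _ _))
      compl := c
      sdiff := fun a b => m a (c b)
      sdiff_eq := fun _ _ => rfl
      himp := fun a b => c (m (c b) (c (c a)))
      himp_eq := fun _ _ => rfl
      top := c o
      bot := o
      le_top := inf_top
      bot_le := fun a => by
        rw [J1, inf_bot]
      inf_compl_le_bot := fun x => by
        change m (m x (c x)) o = m x (c x)
        rw [ho, inf_idem]
      top_le_sup_compl := fun x => by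
        change m (c o) (c (m (c x) (c (c x)))) = c o
        rw [ho, inf_idem] }
  exact ⟨ba, rfl, rfl⟩
end

section
/- Assume a type B with binary operation ∧ and unary operation ' satisfies (J1) x ∧ y = y ∧ x, (J2) (x ∧ y) ∧ z = x ∧ (y ∧ z), (J4) x'' = x, and (J5) x' = (x ∧ y)' ∧ (x ∧ y')' for all x, y, z. Then x ∧ (x ∧ y')' = y ∧ (y ∧ x')' for all x, y ∈ B. -/
/-- Under (J1), (J2), (J4), (J5): x ∧ (x ∧ y')' = y ∧ (y ∧ x')'. -/
theorem johnson_lemma23 {B : Type*} (m : B → B → B) (c : B → B)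
    (J1 : ∀ x y, m x y = m y x)
    (J2 : ∀ x y z, m (m x y) z = m x (m y z))
    (J4 : ∀ x, c (c x) = x)
    (J5 : ∀ x y, c x = m (c (m x y)) (c (m x (c y)))) :
    ∀ x y, m x (c (m x (c y))) = m y (c (m y (c x))) := by
  intro x y
  have decomp (a b : B) : a = m (c (m (c a) b)) (c (m (c a) (c b))) := by
    rw [← J5, J4]
  calc
    m x (c (m x (c y))) = m (m (c (m (c x) y)) (c (m (c x) (c y)))) (c (m x (c y))) := by
      rw [← decomp]
    _ = m (m (c (m (c y) x)) (c (m (c y) (c x)))) (c (m y (c x))) := by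
      rw [J1 (c y) x, J1 (c y) (c x), J1 y (c x), J1 (c (m (c x) y)), J2, J1, J2,
        J1 (c (m (c x) y))]
    _ = m y (c (m y (c x))) := by
      rw [← decomp]
end

section
/- Assume a type B with binary operation ∧ and unary operation ' satisfies (J1) x ∧ y = y ∧ x, (J2) (x ∧ y) ∧ z = x ∧ (y ∧ z), (J4) x'' = x, and (J5) x' = (x ∧ y)' ∧ (x ∧ y')' for all x, y, z. Then x ∧ x' = y ∧ y' for all x, y ∈ B (so the element x ∧ x' is independent of x). -/
/-- Under (J1), (J2), (J4), (J5): x ∧ x' = y ∧ y'. -/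
theorem johnson_lemma24 {B : Type*} (m : B → B → B) (c : B → B)
    (J1 : ∀ x y, m x y = m y x)
    (J2 : ∀ x y z, m (m x y) z = m x (m y z))
    (J4 : ∀ x, c (c x) = x)
    (J5 : ∀ x y, c x = m (c (m x y)) (c (m x (c y)))) :
    ∀ x y, m x (c x) = m y (c y) := by
  intro x y
  have expand : ∀ a b, m a (c a) =
      m (m (c (m (c a) b)) (c (m (c a) (c b)))) (m (c (m a b)) (c (m a (c b)))) := by
    intro a b
    rw [← J5 a b, ← J5 (c a) b, J4]
  have : Std.Commutative m := ⟨J1⟩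
  have : Std.Associative m := ⟨J2⟩
  rw [expand x y, expand y x, J1 y x, J1 (c y) x, J1 y (c x), J1 (c y) (c x)]
  ac_rfl
end

section
/- Assume a type B with binary operation ∧ and unary operation ' satisfies (J1) x ∧ y = y ∧ x, (J2) (x ∧ y) ∧ z = x ∧ (y ∧ z), (J4) x'' = x, and (J5) x' = (x ∧ y)' ∧ (x ∧ y')' for all x, y, z. Then for all a, x, y ∈ B one has (x ∧ y)' = (a ∧ a')' ∧ ((x ∧ y) ∧ x)'. -/
/-- The element `x ∧ x'` does not depend on `x`. -/
theorem johnson_meet_compl_eq {B : Type*} (m : B → B → B) (c : B → B)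
    (J1 : ∀ x y, m x y = m y x)
    (J2 : ∀ x y z, m (m x y) z = m x (m y z))
    (J4 : ∀ x, c (c x) = x)
    (J5 : ∀ x y, c x = m (c (m x y)) (c (m x (c y)))) (x y : B) :
    m x (c x) = m y (c y) := by
  have : Std.Commutative m := ⟨J1⟩
  have : Std.Associative m := ⟨J2⟩
  have expand (u v : B) : u = m (c (m (c u) v)) (c (m (c u) (c v))) := by
    simpa only [J4] using J5 (c u) v
  calc m x (c x)
      = m (m (c (m (c x) y)) (c (m (c x) (c y)))) (m (c (m x y)) (c (m x (c y)))) :=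
        congrArg₂ m (expand x y) (J5 x y)
    _ = m (m (c (m (c y) x)) (c (m (c y) (c x)))) (m (c (m y x)) (c (m y (c x)))) := by
        rw [J1 (c x) y, J1 (c x) (c y), J1 x y, J1 x (c y)]
        ac_rfl
    _ = m y (c y) := (congrArg₂ m (expand y x) (J5 y x)).symm

/-- The meet operation is idempotent. -/
theorem johnson_meet_self {B : Type*} (m : B → B → B) (c : B → B)
    (J1 : ∀ x y, m x y = m y x)
    (J2 : ∀ x y z, m (m x y) z = m x (m y z))
    (J4 : ∀ x, c (c x) = x)
    (J5 : ∀ x y, c x = m (c (m x y)) (c (m x (c y)))) (x : B) :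
    m x x = x := by
  obtain ⟨z, hz⟩ : ∃ z, ∀ y, m y (c y) = z :=
    ⟨m x (c x), fun y => johnson_meet_compl_eq m c J1 J2 J4 J5 y x⟩
  have compl_eq (y : B) : c y = m (c z) (c (m y y)) := by
    have h := J5 y (c y)
    rwa [hz, J4] at h
  have top_bot : m (c z) z = z := by rw [J1, hz]
  have bot_bot : m z z = z := by
    have h := J5 (c z) (m z z)
    rw [← compl_eq z, ← J2, top_bot, J4] at h
    calc m z z = m z (m (c (m z z)) z) := by rw [← h]
      _ = m (m z z) (c (m z z)) := by rw [J1 (c (m z z)) z, J2]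
      _ = z := hz _
  have top_top : m (c z) (c z) = c z := by
    have h := compl_eq z
    rw [bot_bot] at h
    exact h.symm
  have top_meet (y : B) : m (c z) y = y := by
    have h := compl_eq (c y)
    rw [J4] at h
    rw [h, ← J2, top_top]
  have h := compl_eq x
  rw [top_meet] at h
  rw [← J4 (m x x), ← h, J4]

/-- Under (J1), (J2), (J4), (J5): (x ∧ y)' = (a ∧ a')' ∧ ((x ∧ y) ∧ x)',
where a ∧ a' plays the role of 0. -/
theorem johnson_lemma210 {B : Type*} (m : B → B → B) (c : B → B)
    (J1 : ∀ x y, m x y = m y x)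
    (J2 : ∀ x y z, m (m x y) z = m x (m y z))
    (J4 : ∀ x, c (c x) = x)
    (J5 : ∀ x y, c x = m (c (m x y)) (c (m x (c y)))) :
    ∀ a x y, c (m x y) = m (c (m a (c a))) (c (m (m x y) x)) := by
  intro a x y
  have const := johnson_meet_compl_eq m c J1 J2 J4 J5
  have bot : m (m x y) (c x) = m a (c a) := by
    calc m (m x y) (c x) = m y (m x (c x)) := by rw [J1 x y, J2]
      _ = m (m y y) (c y) := by rw [const x y, J2]
      _ = m a (c a) := by rw [johnson_meet_self m c J1 J2 J4 J5, const y a]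
  rw [← bot, J1 (c _)]
  exact J5 (m x y) x
end

section
/- Assume a type B with binary operation ∧ and unary operation ' satisfies (J1) x ∧ y = y ∧ x, (J2) (x ∧ y) ∧ z = x ∧ (y ∧ z), (J4) x'' = x, and (J5) x' = (x ∧ y)' ∧ (x ∧ y')' for all x, y, z. Then ((x ∧ y) ∧ x)' = (y ∧ x)' for all x, y ∈ B. -/
/-- Under (J1), (J2), (J4), (J5): ((x ∧ y) ∧ x)' = (y ∧ x)'. -/
theorem johnson_lemma212 {B : Type*} (m : B → B → B) (c : B → B)
    (J1 : ∀ x y, m x y = m y x)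
    (J2 : ∀ x y z, m (m x y) z = m x (m y z))
    (J4 : ∀ x, c (c x) = x)
    (J5 : ∀ x y, c x = m (c (m x y)) (c (m x (c y)))) :
    ∀ x y, c (m (m x y) x) = c (m y x) := by
  have left_comm : ∀ a b d, m a (m b d) = m b (m a d) := fun a b d => by
    rw [← J2, J1 a b, J2]
  have huntington : ∀ x y, x = m (c (m (c x) y)) (c (m (c x) (c y))) := fun x y => by
    rw [← J5, J4]
  have compl_const : ∀ x y, m x (c x) = m y (c y) := fun x y => calc
    m x (c x) = m (m (c (m (c x) y)) (c (m (c x) (c y))))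
        (m (c (m x y)) (c (m x (c y)))) := by rw [← huntington, ← J5]
    _ = m (m (c (m (c y) x)) (c (m (c y) (c x))))
        (m (c (m y x)) (c (m y (c x)))) := by
      rw [J1 (c y) x, J1 (c y) (c x), J1 y x, J1 y (c x)]
      simp only [J1, J2, left_comm]
    _ = m y (c y) := by rw [← huntington, ← J5]
  have idem : ∀ x, m x x = x := by
    intro x
    obtain ⟨e, he⟩ : ∃ e, ∀ z, m z (c z) = e := ⟨_, fun z => compl_const z x⟩
    have absorb : m (c (m e e)) (c e) = c e := by
      have h := J5 e e
      rw [he] at h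
      exact h.symm
    have e_idem : m e e = e := by
      have h : m e (c (m e e)) = e := by
        have := he e
        rwa [← absorb, J1 (c (m e e)), ← J2, he] at this
      have h' := he (m e e)
      rwa [J2, h] at h'
    rw [e_idem] at absorb
    have expand : ∀ z, c z = m (c (m z z)) (c e) := fun z => by
      conv_lhs => rw [J5 z z, he]
    have bot_unit : ∀ z, m (c z) (c e) = c z := fun z => by
      rw [expand z, J2, absorb]
    rw [← J4 (m x x), ← bot_unit (m x x), ← expand, J4]
  intro x y
  rw [J1 x y, J2, idem]
end

section
/- The identities (A6) and (J5') form a 2-base for Boolean algebras: if a nonempty type B equipped with a binary operation ∧ and a unary operation ' satisfies (A6) x ∧ (y ∧ z) = y ∧ (z ∧ x) and (J5') x = (x' ∧ y)' ∧ (x' ∧ y')' for all x, y, z ∈ B, then there exists a Boolean algebra structure on B whose infimum operation is ∧ and whose complement operation is '. -/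
section CyclicIdentity

variable {B : Type*} {m : B → B → B}

theorem comm_of_cyclic_six (A6 : ∀ x y z, m x (m y z) = m y (m z x)) (p q r s u v : B) :
    m (m p q) (m r (m s (m u v))) = m (m r (m s (m u v))) (m p q) := by
  calc m (m p q) (m r (m s (m u v)))
      = m (m p q) (m (m u v) (m r s)) := by rw [A6 r, A6 s]
    _ = m (m r s) (m (m p q) (m u v)) := by rw [A6 (m r s)]
    _ = m (m r s) (m u (m v (m p q))) := by rw [A6 (m p q), A6 u]
    _ = m (m r s) (m u (m p (m q v))) := by rw [A6 v]
    _ = m (m r s) (m (m q v) (m u p)) := by rw [A6 u, A6 p]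
    _ = m (m q v) (m (m u p) (m r s)) := A6 _ _ _
    _ = m (m q v) (m r (m s (m u p))) := by rw [A6 (m u p)]
    _ = m (m q v) (m r (m p (m s u))) := by rw [A6 s, A6 u]
    _ = m (m q v) (m p (m (m s u) r)) := by rw [A6 r]
    _ = m p (m (m (m s u) r) (m q v)) := A6 _ _ _
    _ = m p (m q (m v (m (m s u) r))) := by rw [A6 (m (m s u) r)]
    _ = m (m v (m (m s u) r)) (m p q) := by rw [A6 (m v _)]
    _ = m (m r (m s (m u v))) (m p q) := by rw [A6 v, A6 (m s u), A6 v]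

theorem comm_of_cyclic_of_surjective (A6 : ∀ x y z, m x (m y z) = m y (m z x))
    (surj : ∀ x, ∃ y z, x = m y z) (x y : B) : m x y = m y x := by
  obtain ⟨p, q, rfl⟩ := surj x
  obtain ⟨r, w, rfl⟩ := surj y
  obtain ⟨s, w, rfl⟩ := surj w
  obtain ⟨u, v, rfl⟩ := surj w
  exact comm_of_cyclic_six A6 p q r s u v

end CyclicIdentity

/-- A commutative semigroup with a unary operation satisfying Huntington's equation. -/
structure IsHuntington {B : Type*} (m : B → B → B) (c : B → B) : Prop where
  comm : ∀ x y, m x y = m y x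
  assoc : ∀ x y z, m (m x y) z = m x (m y z)
  huntington : ∀ x y, m (c (m (c x) y)) (c (m (c x) (c y))) = x

namespace IsHuntington

variable {B : Type*} {m : B → B → B} {c : B → B}

theorem left_comm (h : IsHuntington m c) (x y z : B) : m x (m y z) = m y (m x z) := by
  rw [← h.assoc, h.comm x, h.assoc]

theorem mul_compl_self_eq_compl_mul (h : IsHuntington m c) (x : B) :
    m x (c x) = m (c x) (c (c x)) := by
  have h1 := h.huntington x (c (c x))
  have h2 := h.huntington (c x) (c (c x))
  have h3 := h.huntington (c x) (c x)
  have h4 := h.huntington (c (c x)) (c x)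
  calc m x (c x) = m (m _ _) (m _ _) := (congrArg₂ m h1 h2).symm
    _ = m (m _ _) (m _ _) := by
      simp only [h.comm, h.left_comm, h.assoc]
    _ = m (c x) (c (c x)) := congrArg₂ m h3 h4

theorem compl_compl (h : IsHuntington m c) (x : B) : c (c x) = x := by
  have h1 := h.huntington x (c (c x))
  have h2 := h.huntington (c (c x)) (c x)
  rw [h.comm (c (c (c x))) (c (c x)), ← h.mul_compl_self_eq_compl_mul (c x),
    h.comm (c (c (c x))), h.comm] at h2
  exact h2.symm.trans h1

theorem mul_compl_self_eq (h : IsHuntington m c) (x y : B) : m x (c x) = m y (c y) := by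
  have hx := congrArg₂ m (h.huntington x y) (h.huntington (c x) y)
  have hy := congrArg₂ m (h.huntington y x) (h.huntington (c y) x)
  rw [h.compl_compl] at hx hy
  rw [← hx, ← hy, h.comm y x, h.comm (c y) x, h.comm y (c x), h.comm (c y) (c x)]
  simp only [h.comm, h.left_comm, h.assoc]

theorem mul_self (h : IsHuntington m c) (x : B) : m x x = x := by
  obtain ⟨t, ht⟩ : ∃ t, ∀ y, m y (c y) = t := ⟨_, fun y => h.mul_compl_self_eq y x⟩
  have key : ∀ y, m (c t) (c (m (c y) (c y))) = y := fun y => by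
    have := h.huntington y y
    rwa [h.comm (c y) y, ht] at this
  have hz : m (c (m t t)) (c t) = c t := by
    have := h.huntington (c t) t
    rwa [h.compl_compl, ht] at this
  have h1 : m t (c (m t t)) = t := by
    calc m t (c (m t t)) = m (m t (c t)) (c (m t t)) := by rw [ht]
      _ = m t (m (c (m t t)) (c t)) := by rw [h.assoc, h.comm (c t)]
      _ = t := by rw [hz, ht]
  have h2 : m t t = t := by
    calc m t t = m t (m t (c (m t t))) := by rw [h1]
      _ = t := by rw [← h.assoc, ht]
  have h3 : m (c t) (c t) = c t := by rwa [h2] at hz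
  have h4 : ∀ y, m (c t) y = y := fun y => by
    calc m (c t) y = m (c t) (m (c t) (c (m (c y) (c y)))) := by rw [key]
      _ = y := by rw [← h.assoc, h3, key]
  have h5 := key (c x)
  rw [h4, h.compl_compl] at h5
  rw [← h.compl_compl (m x x), h5, h.compl_compl]

theorem mul_compl_absorb (h : IsHuntington m c) (x y : B) : m x (c (m (c x) y)) = x := by
  have key := h.huntington x y
  calc m x (c (m (c x) y))
      = m (c (m (c x) y)) (m (c (m (c x) y)) (c (m (c x) (c y)))) := by rw [key, h.comm]
    _ = x := by rw [← h.assoc, h.mul_self, key]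

theorem mul_compl_self_mul (h : IsHuntington m c) (x y : B) : m (m x (c x)) y = m x (c x) := by
  rw [h.mul_compl_self_eq x y, h.comm, ← h.assoc, h.mul_self]

theorem mul_eq_left_of_mul_compl (h : IsHuntington m c) {x y : B}
    (hxy : m x (c y) = m x (c x)) : m x y = x := by
  have key := h.huntington (c x) y
  have hz := h.mul_compl_absorb (c (m x y)) (c (m x y))
  rw [h.comm (c (c (m x y))), h.mul_compl_self_eq _ x] at hz
  rw [h.compl_compl, hxy, hz] at key
  rw [← h.compl_compl (m x y), key, h.compl_compl]

theorem compl_eq_of_mul_eq (h : IsHuntington m c) {x y : B} (hxy : m x y = x) :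
    m (c x) (c y) = c y := by
  have key := h.mul_compl_absorb (c y) x
  rwa [h.compl_compl, h.comm y, hxy, h.comm] at key

/-- The Boolean algebra whose infimum and complement are the operations of a Huntington algebra. -/
abbrev booleanAlgebra (h : IsHuntington m c) (b : B) : BooleanAlgebra B where
  le x y := m x y = x
  le_refl := h.mul_self
  le_trans x y z hxy hyz := by
    rw [← hxy, h.assoc, hyz]
  le_antisymm x y hxy hyx := by
    rw [← hxy, h.comm, hyx]
  inf := m
  inf_le_left x y := by
    rw [h.comm, ← h.assoc, h.mul_self]
  inf_le_right x y := by
    rw [h.assoc, h.mul_self]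
  le_inf x y z hxy hxz := by
    rw [← h.assoc, hxy, hxz]
  sup x y := c (m (c x) (c y))
  le_sup_left x y := h.mul_compl_absorb x (c y)
  le_sup_right x y := by
    rw [h.comm (c x), h.mul_compl_absorb]
  sup_le x y z hxz hyz := by
    have hx := h.compl_eq_of_mul_eq hxz
    have hy := h.compl_eq_of_mul_eq hyz
    have key : m (c z) (m (c x) (c y)) = c z := by
      rw [← h.assoc, h.comm (c z), hx, h.comm, hy]
    have := h.compl_eq_of_mul_eq key
    rw [h.compl_compl] at this
    change m (c (m (c x) (c y))) z = c (m (c x) (c y))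
    rw [h.comm] at this ⊢
    rwa [h.comm]
  le_sup_inf x y z := by
    have residual : ∀ w, m (m (c (m (c x) (c w))) (c x)) w = m (c (m (c x) (c w))) (c x) :=
      fun w => h.mul_eq_left_of_mul_compl (by
        rw [h.assoc, h.comm, h.mul_compl_self_eq])
    have hy := residual y
    have hz := residual z
    change m (m (c (m (c x) (c y))) (c (m (c x) (c z)))) (c (m (c x) (c (m y z)))) =
      m (c (m (c x) (c y))) (c (m (c x) (c z)))
    generalize c (m (c x) (c y)) = p at hy ⊢
    generalize c (m (c x) (c z)) = q at hz ⊢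
    have hyz : m (m (m p q) (c x)) (m y z) = m (m p q) (c x) := by
      calc m (m (m p q) (c x)) (m y z)
          = m (m (m p q) (m (c x) (c x))) (m y z) := by rw [h.mul_self]
        _ = m (m (m p (c x)) y) (m (m q (c x)) z) := by
          simp only [h.assoc, h.left_comm, h.comm]
        _ = m (m p q) (m (c x) (c x)) := by
          rw [hy, hz]
          simp only [h.assoc, h.left_comm]
        _ = m (m p q) (c x) := by rw [h.mul_self]
    refine h.mul_eq_left_of_mul_compl ?_
    rw [h.compl_compl, ← h.assoc, ← hyz, h.assoc, h.comm, h.mul_compl_self_mul,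
      h.mul_compl_self_eq]
  compl := c
  top := c (m b (c b))
  bot := m b (c b)
  le_top x := by
    have := h.mul_compl_absorb x x
    rwa [h.comm (c x), h.mul_compl_self_eq x b] at this
  bot_le := h.mul_compl_self_mul b
  inf_compl_le_bot x := by
    change m (m x (c x)) (m b (c b)) = _
    exact h.mul_compl_self_mul _ _
  top_le_sup_compl x := by
    change m (c (m b (c b))) (c (m (c x) (c (c x)))) = c (m b (c b))
    rw [h.mul_compl_self_eq (c x) b, h.mul_self]

end IsHuntington

/-- (A6) and (J5') form a 2-base for Boolean algebras. -/
theorem A6_J5'_base {B : Type*} [Nonempty B] (m : B → B → B) (c : B → B)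
    (A6 : ∀ x y z, m x (m y z) = m y (m z x))
    (J5' : ∀ x y, x = m (c (m (c x) y)) (c (m (c x) (c y)))) :
    ∃ ba : BooleanAlgebra B, ba.inf = m ∧ ba.compl = c := by
  have comm := comm_of_cyclic_of_surjective A6 fun x => ⟨_, _, J5' x x⟩
  have h : IsHuntington m c :=
    { comm := comm
      assoc := fun x y z => by rw [comm, A6]
      huntington := fun x y => (J5' x y).symm }
  obtain ⟨b⟩ := ‹Nonempty B›
  exact ⟨h.booleanAlgebra b, rfl, rfl⟩
end

section
/- Assume a type B with binary operation ∧ and unary operation ' satisfies (A6) x ∧ (y ∧ z) = y ∧ (z ∧ x) and (J5') x = (x' ∧ y)' ∧ (x' ∧ y')' for all x, y, z. Then (x ∧ y) ∧ z = (z ∧ y) ∧ x for all x, y, z ∈ B. -/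
/-- Under (A6) alone, the outer factors of `(x ∧ y) ∧ z` may be exchanged
when both of them are products. -/
theorem outer_exchange_of_cyclic {B : Type*} (m : B → B → B)
    (A6 : ∀ x y z, m x (m y z) = m y (m z x)) (a b y d e : B) :
    m (m (m a b) y) (m d e) = m (m (m d e) y) (m a b) :=
  calc m (m (m a b) y) (m d e)
    _ = m d (m e (m (m a b) y)) := A6 _ _ _
    _ = m d (m (m a b) (m y e)) := congrArg (m d) (A6 _ _ _)
    _ = m (m y e) (m d (m a b)) := (A6 _ _ _).symm
    _ = m (m y e) (m a (m b d)) := congrArg (m (m y e)) (A6 _ _ _)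
    _ = m a (m (m b d) (m y e)) := A6 _ _ _
    _ = m a (m y (m e (m b d))) := congrArg (m a) (A6 _ _ _)
    _ = m a (m y (m b (m d e))) := congrArg (fun t => m a (m y t)) (A6 _ _ _)
    _ = m a (m b (m (m d e) y)) := congrArg (m a) (A6 _ _ _)
    _ = m (m (m d e) y) (m a b) := (A6 _ _ _).symm

/-- Under (A6) and (J5'): (x ∧ y) ∧ z = (z ∧ y) ∧ x. -/
theorem A6_J5'_lemma416 {B : Type*} (m : B → B → B) (c : B → B)
    (A6 : ∀ x y z, m x (m y z) = m y (m z x))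
    (J5' : ∀ x y, x = m (c (m (c x) y)) (c (m (c x) (c y)))) :
    ∀ x y z, m (m x y) z = m (m z y) x := by
  intro x y z
  have h := outer_exchange_of_cyclic m A6 (c (m (c x) x)) (c (m (c x) (c x))) y
    (c (m (c z) z)) (c (m (c z) (c z)))
  rwa [← J5' x x, ← J5' z z] at h
end

section
/- Assume a type B with binary operation ∧ and unary operation ' satisfies (A6) x ∧ (y ∧ z) = y ∧ (z ∧ x) and (J5') x = (x' ∧ y)' ∧ (x' ∧ y')' for all x, y, z. Then the commutative law x ∧ y = y ∧ x holds for all x, y ∈ B. -/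
/-- Cyclic associativity alone lets a binary product commute with a right-nested
fourfold product. -/
theorem cyclic_assoc_comm_of_products {B : Type*} (m : B → B → B)
    (A6 : ∀ x y z, m x (m y z) = m y (m z x)) (a b d e f g : B) :
    m (m a b) (m d (m e (m f g))) = m (m d (m e (m f g))) (m a b) :=
  calc m (m a b) (m d (m e (m f g)))
    _ = m (m a b) (m (m f g) (m d e)) := by rw [A6 d e, A6 e (m f g)]
    _ = m (m d e) (m (m a b) (m f g)) := by rw [← A6 (m d e)]
    _ = m (m d e) (m f (m g (m a b))) := by rw [A6 (m a b) f g]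
    _ = m (m d e) (m f (m a (m b g))) := by rw [A6 g a b]
    _ = m (m d e) (m (m b g) (m f a)) := by rw [A6 f a, A6 a (m b g)]
    _ = m (m b g) (m (m f a) (m d e)) := by rw [A6 (m d e)]
    _ = m (m b g) (m d (m e (m f a))) := by rw [A6 (m f a) d e]
    _ = m (m b g) (m d (m a (m e f))) := by rw [← A6 a e f]
    _ = m (m b g) (m a (m (m e f) d)) := by rw [A6 d a]
    _ = m a (m (m (m e f) d) (m b g)) := by rw [A6 (m b g)]
    _ = m a (m b (m g (m (m e f) d))) := by rw [A6 (m (m e f) d) b g]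
    _ = m (m g (m (m e f) d)) (m a b) := by rw [← A6 (m g (m (m e f) d)) a b]
    _ = m (m d (m g (m e f))) (m a b) := by rw [A6 d g]
    _ = m (m d (m e (m f g))) (m a b) := by rw [A6 g e f]

/-- Under (A6) and (J5') the commutative law holds. -/
theorem A6_J5'_comm {B : Type*} (m : B → B → B) (c : B → B)
    (A6 : ∀ x y z, m x (m y z) = m y (m z x))
    (J5' : ∀ x y, x = m (c (m (c x) y)) (c (m (c x) (c y)))) :
    ∀ x y, m x y = m y x := by
  have exists_factors : ∀ x, ∃ a b, x = m a b := fun x => ⟨_, _, J5' x x⟩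
  intro x y
  obtain ⟨a, b, rfl⟩ := exists_factors x
  obtain ⟨d, u, rfl⟩ := exists_factors y
  obtain ⟨e, v, rfl⟩ := exists_factors u
  obtain ⟨f, g, rfl⟩ := exists_factors v
  exact cyclic_assoc_comm_of_products m A6 a b d e f g
end

section
/- Assume a type B with binary operation ∧ and unary operation ' satisfies (A6) x ∧ (y ∧ z) = y ∧ (z ∧ x) and (J5') x = (x' ∧ y)' ∧ (x' ∧ y')' for all x, y, z. Then the associative law x ∧ (y ∧ z) = (x ∧ y) ∧ z holds for all x, y, z ∈ B. -/
/-- An element `a b` commutes with an element `(c d) (e f)` as soon as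
`x (y z) = y (z x)` holds identically. -/
theorem mul_comm_of_products {B : Type*} (m : B → B → B)
    (A6 : ∀ x y z, m x (m y z) = m y (m z x)) (a b c d e f : B) :
    m (m a b) (m (m c d) (m e f)) = m (m (m c d) (m e f)) (m a b) :=
  calc
    m (m a b) (m (m c d) (m e f))
      = m (m e f) (m (m a b) (m c d)) := (A6 (m e f) (m a b) (m c d)).symm
    _ = m (m e f) (m c (m d (m a b))) := congrArg (m (m e f)) (A6 (m a b) c d)
    _ = m (m e f) (m c (m a (m b d))) := congrArg (m (m e f)) (congrArg (m c) (A6 d a b))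
    _ = m (m e f) (m (m b d) (m c a)) := congrArg (m (m e f)) ((A6 (m b d) c a).symm)
    _ = m (m b d) (m (m c a) (m e f)) := A6 (m e f) (m b d) (m c a)
    _ = m (m b d) (m e (m f (m c a))) := congrArg (m (m b d)) (A6 (m c a) e f)
    _ = m (m b d) (m e (m a (m f c))) := congrArg (m (m b d)) (congrArg (m e) ((A6 a f c).symm))
    _ = m (m b d) (m a (m (m f c) e)) := congrArg (m (m b d)) (A6 e a (m f c))
    _ = m a (m (m (m f c) e) (m b d)) := A6 (m b d) a (m (m f c) e)
    _ = m a (m b (m d (m (m f c) e))) := congrArg (m a) (A6 (m (m f c) e) b d)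
    _ = m (m d (m (m f c) e)) (m a b) := (A6 (m d (m (m f c) e)) a b).symm
    _ = m (m e (m d (m f c))) (m a b) := congrArg (m · (m a b)) ((A6 e d (m f c)).symm)
    _ = m (m e (m f (m c d))) (m a b) := congrArg (m · (m a b)) (congrArg (m e) (A6 d f c))
    _ = m (m (m c d) (m e f)) (m a b) := congrArg (m · (m a b)) ((A6 (m c d) e f).symm)

/-- If every element is a product, then `x (y z) = y (z x)` implies commutativity. -/
theorem comm_of_cyclic_of_forall_eq_mul {B : Type*} (m : B → B → B)
    (A6 : ∀ x y z, m x (m y z) = m y (m z x)) (factor : ∀ x, ∃ y z, x = m y z) (x y : B) :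
    m x y = m y x := by
  obtain ⟨a, b, rfl⟩ := factor x
  obtain ⟨u, v, rfl⟩ := factor y
  obtain ⟨c, d, rfl⟩ := factor u
  obtain ⟨e, f, rfl⟩ := factor v
  exact mul_comm_of_products m A6 a b c d e f

/-- Under (A6) and (J5') the associative law holds. -/
theorem A6_J5'_assoc {B : Type*} (m : B → B → B) (c : B → B)
    (A6 : ∀ x y z, m x (m y z) = m y (m z x))
    (J5' : ∀ x y, x = m (c (m (c x) y)) (c (m (c x) (c y)))) :
    ∀ x y z, m x (m y z) = m (m x y) z := by
  intro x y z
  rw [comm_of_cyclic_of_forall_eq_mul m A6 (fun x => ⟨_, _, J5' x x⟩) (m x y) z]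
  exact (A6 z x y).symm
end

section
/- The identities (A8) and (J5') form a 2-base for Boolean algebras: if a nonempty type B equipped with a binary operation ∧ and a unary operation ' satisfies (A8) x ∧ (y ∧ z) = (z ∧ x) ∧ y and (J5') x = (x' ∧ y)' ∧ (x' ∧ y')' for all x, y, z ∈ B, then there exists a Boolean algebra structure on B whose infimum operation is ∧ and whose complement operation is '. -/
/-- A commutative semigroup with a unary operation satisfying Huntington's equation. -/
class HuntingtonAlgebra (α : Type*) extends CommSemigroup α, Compl α where
  huntington (x y : α) : (xᶜ * y)ᶜ * (xᶜ * yᶜ)ᶜ = x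

namespace HuntingtonAlgebra

variable {α : Type*} [HuntingtonAlgebra α]

theorem mul_compl_eq_mul_compl (x y : α) : x * xᶜ = y * yᶜ := by
  calc x * xᶜ
      = ((xᶜ * yᶜ)ᶜ * (xᶜ * yᶜᶜ)ᶜ) * ((xᶜᶜ * yᶜ)ᶜ * (xᶜᶜ * yᶜᶜ)ᶜ) := by
        rw [huntington, huntington]
    _ = ((yᶜ * xᶜ)ᶜ * (yᶜ * xᶜᶜ)ᶜ) * ((yᶜᶜ * xᶜ)ᶜ * (yᶜᶜ * xᶜᶜ)ᶜ) := by ac_rfl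
    _ = y * yᶜ := by rw [huntington, huntington]

protected theorem compl_compl (x : α) : xᶜᶜ = x := by
  calc xᶜᶜ = (xᶜᶜᶜ * xᶜ)ᶜ * (xᶜᶜᶜ * xᶜᶜ)ᶜ := (huntington xᶜᶜ xᶜ).symm
    _ = (xᶜ * xᶜᶜ)ᶜ * (xᶜ * xᶜᶜᶜ)ᶜ := by
        rw [mul_comm xᶜᶜᶜ xᶜᶜ, mul_compl_eq_mul_compl xᶜᶜ xᶜ, mul_comm xᶜᶜᶜ xᶜ, mul_comm]
    _ = x := huntington x xᶜᶜ

theorem mul_compl_mul_mul_compl (x : α) : (x * xᶜ) * (x * xᶜ) = x * xᶜ := by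
  have hz (y : α) : y * yᶜ = x * xᶜ := mul_compl_eq_mul_compl y x
  generalize x * xᶜ = z at hz ⊢
  have hi : (z * z)ᶜ * zᶜ = zᶜ := by
    simpa only [HuntingtonAlgebra.compl_compl, hz] using huntington zᶜ z
  have h : z * (z * z)ᶜ = z := by
    calc z * (z * z)ᶜ = (z * zᶜ) * (z * z)ᶜ := by rw [hz]
      _ = z * ((z * z)ᶜ * zᶜ) := by ac_rfl
      _ = z := by rw [hi, hz]
  calc z * z = z * (z * (z * z)ᶜ) := by rw [h]
    _ = (z * z) * (z * z)ᶜ := (mul_assoc _ _ _).symm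
    _ = z := hz _

theorem mul_compl_mul_compl (x y : α) : x * (y * yᶜ)ᶜ = x := by
  have hz (u : α) : u * uᶜ = y * yᶜ := mul_compl_eq_mul_compl u y
  have hzz := mul_compl_mul_mul_compl y
  generalize y * yᶜ = z at hz hzz ⊢
  have hi : zᶜ * zᶜ = zᶜ := by
    simpa only [HuntingtonAlgebra.compl_compl, hz, hzz] using huntington zᶜ z
  have hx : zᶜ * (xᶜ * xᶜ)ᶜ = x := by
    simpa only [mul_comm xᶜ x, hz] using huntington x x
  calc x * zᶜ = (zᶜ * zᶜ) * (xᶜ * xᶜ)ᶜ := by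
        conv_lhs => rw [← hx]
        ac_rfl
    _ = x := by rw [hi, hx]

protected theorem mul_self (x : α) : x * x = x := by
  have h := huntington xᶜ xᶜ
  rw [mul_comm xᶜᶜ xᶜ, mul_comm, mul_compl_mul_compl] at h
  simpa only [HuntingtonAlgebra.compl_compl] using congrArg (·ᶜ) h

theorem mul_mul_compl (x y : α) : x * (y * yᶜ) = y * yᶜ := by
  rw [mul_compl_eq_mul_compl y x, ← mul_assoc, HuntingtonAlgebra.mul_self]

theorem mul_compl_mul_compl_compl (x y : α) : x * (xᶜ * yᶜ)ᶜ = x := by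
  calc x * (xᶜ * yᶜ)ᶜ = (xᶜ * y)ᶜ * (xᶜ * yᶜ)ᶜ * (xᶜ * yᶜ)ᶜ := by rw [huntington]
    _ = x := by rw [mul_assoc, HuntingtonAlgebra.mul_self, huntington]

theorem compl_mul_compl_of_mul_eq {x y : α} (h : x * y = x) : yᶜ * xᶜ = yᶜ := by
  simpa only [HuntingtonAlgebra.compl_compl, mul_comm y x, h] using
    mul_compl_mul_compl_compl yᶜ xᶜ

theorem mul_eq_of_mul_compl_eq {x y : α} (h : x * yᶜ = x * xᶜ) : x * y = x := by
  have hx := huntington xᶜ y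
  rw [HuntingtonAlgebra.compl_compl, h, mul_compl_mul_compl] at hx
  simpa only [HuntingtonAlgebra.compl_compl] using congrArg (·ᶜ) hx

/-- The meet semilattice of a Huntington algebra. -/
abbrev toSemilatticeInf : SemilatticeInf α where
  inf x y := x * y
  le x y := x * y = x
  le_refl := HuntingtonAlgebra.mul_self
  le_trans x y z hxy hyz := by rw [← hxy, mul_assoc, hyz]
  le_antisymm x y hxy hyx := by rw [← hxy, mul_comm, hyx]
  inf_le_left x y := by rw [mul_right_comm, HuntingtonAlgebra.mul_self]
  inf_le_right x y := by rw [mul_assoc, HuntingtonAlgebra.mul_self]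
  le_inf x y z hxy hxz := by rw [← mul_assoc, hxy, hxz]

/-- The lattice of a Huntington algebra, with joins given by De Morgan's law. -/
abbrev toLattice : Lattice α where
  __ := toSemilatticeInf
  sup x y := (xᶜ * yᶜ)ᶜ
  le_sup_left := mul_compl_mul_compl_compl
  le_sup_right x y := by
    rw [mul_comm xᶜ]
    exact mul_compl_mul_compl_compl y x
  sup_le x y z hxz hyz := by
    have h : zᶜ * (xᶜ * yᶜ) = zᶜ := by
      rw [← mul_assoc, compl_mul_compl_of_mul_eq hxz, compl_mul_compl_of_mul_eq hyz]
    change (xᶜ * yᶜ)ᶜ * z = (xᶜ * yᶜ)ᶜ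
    simpa only [HuntingtonAlgebra.compl_compl] using compl_mul_compl_of_mul_eq h

theorem sup_mul_compl_mul (x y : α) :
    ((xᶜ * yᶜ)ᶜ * xᶜ) * y = (xᶜ * yᶜ)ᶜ * xᶜ := by
  apply mul_eq_of_mul_compl_eq
  rw [mul_assoc, mul_comm, mul_compl_eq_mul_compl]

theorem sup_mul_sup_mul_sup_mul (x y z : α) :
    ((xᶜ * yᶜ)ᶜ * (xᶜ * zᶜ)ᶜ) * (xᶜ * (y * z)ᶜ)ᶜ = (xᶜ * yᶜ)ᶜ * (xᶜ * zᶜ)ᶜ := by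
  apply mul_eq_of_mul_compl_eq
  rw [HuntingtonAlgebra.compl_compl]
  calc (xᶜ * yᶜ)ᶜ * (xᶜ * zᶜ)ᶜ * (xᶜ * (y * z)ᶜ)
      = (xᶜ * yᶜ)ᶜ * (xᶜ * zᶜ)ᶜ * ((xᶜ * xᶜ) * (y * z)ᶜ) := by
        rw [HuntingtonAlgebra.mul_self]
    _ = ((xᶜ * yᶜ)ᶜ * xᶜ) * ((xᶜ * zᶜ)ᶜ * xᶜ) * (y * z)ᶜ := by ac_rfl
    _ = (((xᶜ * yᶜ)ᶜ * xᶜ) * y) * (((xᶜ * zᶜ)ᶜ * xᶜ) * z) * (y * z)ᶜ := by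
        rw [sup_mul_compl_mul, sup_mul_compl_mul]
    _ = (((xᶜ * yᶜ)ᶜ * xᶜ) * ((xᶜ * zᶜ)ᶜ * xᶜ)) * ((y * z) * (y * z)ᶜ) := by ac_rfl
    _ = (y * z) * (y * z)ᶜ := mul_mul_compl _ _
    _ = _ := mul_compl_eq_mul_compl _ _

/-- The Boolean algebra of a nonempty Huntington algebra, with multiplication as meet. -/
noncomputable abbrev toBooleanAlgebra [Nonempty α] : BooleanAlgebra α where
  __ := toLattice
  le_sup_inf := sup_mul_sup_mul_sup_mul
  compl x := xᶜ
  bot := Classical.arbitrary α * (Classical.arbitrary α)ᶜ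
  top := (Classical.arbitrary α * (Classical.arbitrary α)ᶜ)ᶜ
  bot_le x := by
    change _ * x = _
    rw [mul_comm, mul_mul_compl]
  le_top x := mul_compl_mul_compl x _
  inf_compl_le_bot x := by
    change (x * xᶜ) * (_ * _) = x * xᶜ
    rw [mul_mul_compl, mul_compl_eq_mul_compl]
  top_le_sup_compl x := by
    change _ * (xᶜ * xᶜᶜ)ᶜ = _
    rw [mul_compl_mul_compl]

end HuntingtonAlgebra

theorem mul_comm_of_A8_of_surjective {B : Type*} (m : B → B → B)
    (A8 : ∀ x y z, m x (m y z) = m (m z x) y) (hm : ∀ x, ∃ a b, m a b = x) (x y : B) :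
    m x y = m y x := by
  obtain ⟨a, b, rfl⟩ := hm x
  obtain ⟨c, w, rfl⟩ := hm y
  obtain ⟨d, e, rfl⟩ := hm w
  calc m (m a b) (m c (m d e))
      = m (m (m d e) (m a b)) c := A8 _ _ _
    _ = m (m e (m (m a b) d)) c := by rw [← A8 e]
    _ = m (m (m a b) d) (m c e) := (A8 _ _ _).symm
    _ = m d (m (m c e) (m a b)) := (A8 _ _ _).symm
    _ = m d (m e (m (m a b) c)) := by rw [← A8 e]
    _ = m d (m e (m b (m c a))) := by rw [← A8 b]
    _ = m d (m (m (m c a) e) b) := by rw [A8 e]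
    _ = m (m b d) (m (m c a) e) := A8 _ _ _
    _ = m (m e (m b d)) (m c a) := A8 _ _ _
    _ = m (m a (m e (m b d))) c := A8 _ _ _
    _ = m (m (m (m b d) a) e) c := by rw [A8 a]
    _ = m e (m c (m (m b d) a)) := (A8 _ _ _).symm
    _ = m e (m c (m d (m a b))) := by rw [← A8 d]
    _ = m e (m (m (m a b) c) d) := by rw [A8 c]
    _ = m (m d e) (m (m a b) c) := A8 _ _ _
    _ = m (m c (m d e)) (m a b) := A8 _ _ _

/-- (A8) and (J5') form a 2-base for Boolean algebras. -/
theorem A8_J5'_base {B : Type*} [Nonempty B] (m : B → B → B) (c : B → B)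
    (A8 : ∀ x y z, m x (m y z) = m (m z x) y)
    (J5' : ∀ x y, x = m (c (m (c x) y)) (c (m (c x) (c y)))) :
    ∃ ba : BooleanAlgebra B, ba.inf = m ∧ ba.compl = c := by
  have comm := mul_comm_of_A8_of_surjective m A8 fun x => ⟨_, _, (J5' x x).symm⟩
  let _ : HuntingtonAlgebra B :=
    { mul := m
      compl := c
      mul_comm := comm
      mul_assoc := fun x y z => (comm _ _).trans <| (A8 z x y).trans (comm _ _)
      huntington := fun x y => (J5' x y).symm }
  exact ⟨HuntingtonAlgebra.toBooleanAlgebra, rfl, rfl⟩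
end

section
/- Assume a type B with binary operation ∧ and unary operation ' satisfies (A8) x ∧ (y ∧ z) = (z ∧ x) ∧ y and (J5') x = (x' ∧ y)' ∧ (x' ∧ y')' for all x, y, z. Then the identity (A6) x ∧ (y ∧ z) = y ∧ (z ∧ x) holds for all x, y, z ∈ B. -/
/-- Under the identity (A8), (A6) holds whenever its last argument is a product of the
form `a ∧ (b ∧ d)`. -/
theorem cyclic_of_A8_of_eq_mul_mul {B : Type*} (m : B → B → B)
    (A8 : ∀ x y z, m x (m y z) = m (m z x) y) (x y a b d : B) :
    m x (m y (m a (m b d))) = m y (m (m a (m b d)) x) :=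
  calc m x (m y (m a (m b d)))
    _ = m x (m (m (m b d) y) a) := by rw [A8 y a (m b d)]
    _ = m (m a x) (m (m b d) y) := A8 _ _ _
    _ = m (m y (m a x)) (m b d) := A8 _ _ _
    _ = m (m d (m y (m a x))) b := A8 _ _ _
    _ = m (m (m (m a x) d) y) b := by rw [A8 d y (m a x)]
    _ = m y (m b (m (m a x) d)) := (A8 _ _ _).symm
    _ = m y (m b (m x (m d a))) := by rw [A8 x d a]
    _ = m y (m (m (m d a) b) x) := by rw [A8 b x (m d a)]
    _ = m y (m (m a (m b d)) x) := by rw [A8 a b d]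

/-- Under (A8) and (J5') the identity (A6) holds. -/
theorem A8_J5'_implies_A6 {B : Type*} (m : B → B → B) (c : B → B)
    (A8 : ∀ x y z, m x (m y z) = m (m z x) y)
    (J5' : ∀ x y, x = m (c (m (c x) y)) (c (m (c x) (c y)))) :
    ∀ x y z, m x (m y z) = m y (m z x) := by
  have exists_mul_eq : ∀ w, ∃ u v, w = m u v := fun w => ⟨_, _, J5' w w⟩
  intro x y z
  obtain ⟨a, e, rfl⟩ := exists_mul_eq z
  obtain ⟨b, d, rfl⟩ := exists_mul_eq e
  exact cyclic_of_A8_of_eq_mul_mul m A8 x y a b d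
end

section
/- The identities (A5) and (J5') form a 2-base for Boolean algebras: if a nonempty type B equipped with a binary operation ∧ and a unary operation ' satisfies (A5) x ∧ (y ∧ z) = (y ∧ x) ∧ z and (J5') x = (x' ∧ y)' ∧ (x' ∧ y')' for all x, y, z ∈ B, then there exists a Boolean algebra structure on B whose infimum operation is ∧ and whose complement operation is '. -/
namespace HuntingtonAlgebra

variable {B : Type*} {m : B → B → B} {c : B → B}

theorem mul_left_swap (A5 : ∀ x y z, m x (m y z) = m (m y x) z) (x y z w : B) :
    m x (m y (m z w)) = m x (m z (m y w)) := by
  rw [A5 y z w, A5 x (m z y) w, ← A5 y z x, ← A5 (m z x) y w, ← A5 x z (m y w)]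

theorem compl_mul_compl_mul (A5 : ∀ x y z, m x (m y z) = m (m y x) z)
    (J5 : ∀ x y, x = m (c (m (c x) y)) (c (m (c x) (c y)))) (x y z : B) :
    m (c (m (c x) (c y))) (m (c (m (c x) y)) z) = m x z := by
  rw [A5, ← J5]

theorem mul_compl_compl_comm (A5 : ∀ x y z, m x (m y z) = m (m y x) z)
    (J5 : ∀ x y, x = m (c (m (c x) y)) (c (m (c x) (c y)))) (x y : B) :
    m x (c (m (c x) (c y))) = m (c (m (c x) (c y))) x := by
  rw [← compl_mul_compl_mul A5 J5 x y, ← J5]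

theorem mul_compl_mul_self (A5 : ∀ x y z, m x (m y z) = m (m y x) z)
    (J5 : ∀ x y, x = m (c (m (c x) y)) (c (m (c x) (c y)))) (x y : B) :
    m x (m (c y) (c y)) = m (c y) (m (c y) x) := by
  have h := mul_compl_compl_comm A5 J5 (m (c y) x) (m (c y) (c x))
  rwa [← J5, ← A5] at h

theorem compl_mul_comm (A5 : ∀ x y z, m x (m y z) = m (m y x) z)
    (J5 : ∀ x y, x = m (c (m (c x) y)) (c (m (c x) (c y)))) (x y : B) :
    m (c (m (c x) y)) x = m x (c (m (c x) y)) := by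
  have h := mul_compl_mul_self A5 J5 (c (m (c x) (c y))) (m (c x) y)
  rwa [compl_mul_compl_mul A5 J5, ← J5, eq_comm] at h

theorem mul_compl_mul_rotate (A5 : ∀ x y z, m x (m y z) = m (m y x) z)
    (J5 : ∀ x y, x = m (c (m (c x) y)) (c (m (c x) (c y)))) (x y z : B) :
    m x (m (c (m (c x) y)) z) = m z (m x (c (m (c x) y))) := by
  have h : m z (m (c (m (c x) (c y))) (m (c (m (c x) y)) (c (m (c x) y)))) =
      m (c (m (c x) y)) (m (c (m (c x) (c y))) (m (c (m (c x) y)) z)) := by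
    rw [A5 z, mul_compl_mul_self A5 J5, mul_left_swap A5]
  rw [compl_mul_compl_mul A5 J5, compl_mul_compl_mul A5 J5] at h
  rw [h, A5, compl_mul_comm A5 J5, ← A5]

theorem mul_comm_of_huntington (A5 : ∀ x y z, m x (m y z) = m (m y x) z)
    (J5 : ∀ x y, x = m (c (m (c x) y)) (c (m (c x) (c y)))) (x y : B) :
    m x y = m y x := by
  have hx := J5 x (m (c x) (c y))
  have h := compl_mul_compl_mul A5 J5 x (m (c x) (c y)) y
  rw [← mul_compl_mul_self A5 J5] at hx h
  rw [← h, compl_mul_comm A5 J5, ← mul_compl_mul_rotate A5 J5, ← hx]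

variable [Std.Commutative m] [Std.Associative m]

theorem mul_compl_const (J5 : ∀ x y, x = m (c (m (c x) y)) (c (m (c x) (c y)))) (x y : B) :
    m x (c x) = m y (c y) := by
  have key : ∀ x y, m x (c x) =
      m (m (c (m (c x) y)) (c (m (c x) (c y))))
        (m (c (m (c (c x)) y)) (c (m (c (c x)) (c y)))) := fun x y => by
    rw [← J5, ← J5]
  rw [key x (c y), key y (c x)]
  simp only [Std.Commutative.comm (op := m) (c y), Std.Commutative.comm (op := m) (c (c y))]
  ac_rfl

theorem compl_compl_of_huntington
    (J5 : ∀ x y, x = m (c (m (c x) y)) (c (m (c x) (c y)))) (x : B) : c (c x) = x := by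
  have h := J5 (c (c x)) (c x)
  rw [Std.Commutative.comm (op := m) (c (c (c x))) (c (c x)),
    mul_compl_const J5 (c (c x)) (c x), Std.Commutative.comm (op := m) (c (c (c x)))] at h
  rw [h, Std.Commutative.comm (op := m) (c (m (c x) _)),
    Std.Commutative.comm (op := m) (c (m (c x) (c (c x))))]
  conv_rhs => rw [J5 x (c (c x))]
  ac_rfl

theorem mul_self_of_huntington (J5 : ∀ x y, x = m (c (m (c x) y)) (c (m (c x) (c y)))) (x : B) :
    m x x = x := by
  have cc := compl_compl_of_huntington J5
  obtain ⟨o, ho⟩ : ∃ o, ∀ y, m y (c y) = o := ⟨_, fun y => mul_compl_const J5 y x⟩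
  have hz : ∀ y, y = m (c o) (c (m (c y) (c y))) := fun y => by
    conv_lhs => rw [J5 y y, Std.Commutative.comm (op := m) (c y) y, ho]
  have ho1 : m (c o) o = o := by simpa only [cc] using ho (c o)
  have h0 : c o = m (c o) (c (m o o)) := by simpa only [cc] using hz (c o)
  have hoo : m o o = o := by
    calc m o o = m (m (c o) o) o := by rw [ho1]
      _ = m (m (c o) (c (m o o))) (m o o) := by rw [← h0]; ac_rfl
      _ = m (c o) (m (m o o) (c (m o o))) := by ac_rfl
      _ = o := by rw [ho, ho1]
  rw [hoo] at h0
  have hone : ∀ y, m (c o) y = y := fun y => by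
    calc m (c o) y = m (c o) (m (c o) (c (m (c y) (c y)))) := by rw [← hz]
      _ = m (m (c o) (c o)) (c (m (c y) (c y))) := by ac_rfl
      _ = y := by rw [← h0, ← hz]
  have h := hz (c x)
  rw [hone, cc] at h
  rw [← cc (m x x), ← h, cc]

theorem mul_join_self (J5 : ∀ x y, x = m (c (m (c x) y)) (c (m (c x) (c y)))) (x y : B) :
    m x (c (m (c x) (c y))) = x := by
  calc m x (c (m (c x) (c y)))
      = m (m (c (m (c x) y)) (c (m (c x) (c y)))) (c (m (c x) (c y))) := by rw [← J5]
    _ = m (c (m (c x) y)) (m (c (m (c x) (c y))) (c (m (c x) (c y)))) := by ac_rfl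
    _ = x := by rw [mul_self_of_huntington J5, ← J5]

theorem compl_antitone (J5 : ∀ x y, x = m (c (m (c x) y)) (c (m (c x) (c y)))) {x y : B}
    (h : m x y = x) : m (c y) (c x) = c y := by
  have := mul_join_self J5 (c y) (c x)
  rwa [compl_compl_of_huntington J5, compl_compl_of_huntington J5,
    Std.Commutative.comm (op := m) y, h] at this

theorem mul_bot (J5 : ∀ x y, x = m (c (m (c x) y)) (c (m (c x) (c y)))) (x y : B) :
    m x (m y (c y)) = m y (c y) := by
  rw [mul_compl_const J5 y x]
  calc m x (m x (c x)) = m (m x x) (c x) := by ac_rfl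
    _ = m x (c x) := by rw [mul_self_of_huntington J5]

theorem mul_compl_eq_self (J5 : ∀ x y, x = m (c (m (c x) y)) (c (m (c x) (c y)))) {x y : B}
    (h : m x y = m x (c x)) : m x (c y) = x := by
  have cc := compl_compl_of_huntington J5
  have hy := J5 (c x) y
  have hbot : m (m x (c x)) (m x (c y)) = m x (c x) := by
    rw [Std.Commutative.comm (op := m), mul_bot J5]
  rw [cc, h, Std.Commutative.comm (op := m), compl_antitone J5 hbot] at hy
  rw [← cc (m x (c y)), ← hy, cc]

theorem mul_le_iff_le_residual (J5 : ∀ x y, x = m (c (m (c x) y)) (c (m (c x) (c y))))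
    (a x t : B) : m (m a x) t = m a x ↔ m x (c (m a (c t))) = x := by
  constructor
  · intro h
    apply mul_compl_eq_self J5
    calc m x (m a (c t)) = m (m a x) (c t) := by ac_rfl
      _ = m (m (m a x) t) (c t) := by rw [h]
      _ = m (m a x) (m t (c t)) := by ac_rfl
      _ = m x (c x) := by rw [mul_bot J5, mul_compl_const J5]
  · intro h
    rw [← compl_compl_of_huntington J5 t]
    apply mul_compl_eq_self J5
    calc m (m a x) (c t) = m x (m a (c t)) := by ac_rfl
      _ = m (m x (c (m a (c t)))) (m a (c t)) := by rw [h]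
      _ = m x (m (m a (c t)) (c (m a (c t)))) := by ac_rfl
      _ = m (m a x) (c (m a x)) := by rw [mul_bot J5, mul_compl_const J5]

/-- The lattice with infimum `m` in which suprema are given by De Morgan duality. -/
abbrev lattice (J5 : ∀ x y, x = m (c (m (c x) y)) (c (m (c x) (c y)))) : Lattice B where
  le x y := m x y = x
  le_refl := mul_self_of_huntington J5
  le_trans x y z hxy hyz := by
    rw [← hxy, Std.Associative.assoc (op := m), hyz]
  le_antisymm x y hxy hyx := by
    rw [← hxy, Std.Commutative.comm (op := m), hyx]
  inf := m
  inf_le_left x y := by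
    calc m (m x y) x = m (m x x) y := by ac_rfl
      _ = m x y := by rw [mul_self_of_huntington J5]
  inf_le_right x y := by
    rw [Std.Associative.assoc (op := m), mul_self_of_huntington J5]
  le_inf x y z hxy hxz := by
    rw [← Std.Associative.assoc (op := m), hxy, hxz]
  sup x y := c (m (c x) (c y))
  le_sup_left := mul_join_self J5
  le_sup_right x y := by
    rw [Std.Commutative.comm (op := m) (c x), mul_join_self J5]
  sup_le x y z hxz hyz := by
    have h : m (c z) (m (c x) (c y)) = c z := by
      rw [← Std.Associative.assoc (op := m), compl_antitone J5 hxz, compl_antitone J5 hyz]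
    simpa only [compl_compl_of_huntington J5] using compl_antitone J5 h

/-- A commutative semigroup with a unary operation satisfying the Huntington equation is a
Boolean algebra; the semigroup operation is taken as the infimum. -/
abbrev booleanAlgebra (J5 : ∀ x y, x = m (c (m (c x) y)) (c (m (c x) (c y)))) (b : B) :
    BooleanAlgebra B :=
  letI := lattice J5
  have residual (a x t : B) : a ⊓ x ≤ t ↔ x ≤ c (m a (c t)) := mul_le_iff_le_residual J5 a x t
  have cc := compl_compl_of_huntington J5
  have bot_le (x : B) : m b (c b) ≤ x := by
    change m (m b (c b)) x = _
    rw [Std.Commutative.comm (op := m), mul_bot J5]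
  have le_top (x : B) : x ≤ c (m b (c b)) := by
    have h := compl_antitone J5 (bot_le (c x))
    rwa [cc] at h
  { DistribLattice.ofInfSupLe fun x y z => by
      rw [residual]
      exact sup_le ((residual _ _ _).1 le_sup_left) ((residual _ _ _).1 le_sup_right) with
    compl := c
    bot := m b (c b)
    top := c (m b (c b))
    bot_le := bot_le
    le_top := le_top
    inf_compl_le_bot := fun x => (mul_compl_const J5 x b).le
    top_le_sup_compl := fun x => by
      change c (m b (c b)) ≤ c (m (c x) (c (c x)))
      rw [mul_compl_const J5 (c x) b] }

end HuntingtonAlgebra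

/-- (A5) and (J5') form a 2-base for Boolean algebras. -/
theorem A5_J5'_base {B : Type*} [Nonempty B] (m : B → B → B) (c : B → B)
    (A5 : ∀ x y z, m x (m y z) = m (m y x) z)
    (J5' : ∀ x y, x = m (c (m (c x) y)) (c (m (c x) (c y)))) :
    ∃ ba : BooleanAlgebra B, ba.inf = m ∧ ba.compl = c := by
  have comm := HuntingtonAlgebra.mul_comm_of_huntington A5 J5'
  have : Std.Commutative m := ⟨comm⟩
  have : Std.Associative m := ⟨fun x y z => by rw [A5, comm y x]⟩
  exact ⟨HuntingtonAlgebra.booleanAlgebra J5' (Classical.arbitrary B), rfl, rfl⟩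
end

section
/- Assume a type B with binary operation ∧ and unary operation ' satisfies (A5) x ∧ (y ∧ z) = (y ∧ x) ∧ z and (J5') x = (x' ∧ y)' ∧ (x' ∧ y')' for all x, y, z. Then x ∧ (y ∧ u) = x ∧ (u ∧ y) for all x, y, u ∈ B. -/
section MeetComplement

variable {B : Type*} {m : B → B → B} {c : B → B}

/-- Under (A5), the two middle factors of a right-nested product commute. -/
theorem meet_left_comm_of_A5 (A5 : ∀ x y z, m x (m y z) = m (m y x) z) (x y z w : B) :
    m x (m y (m z w)) = m x (m z (m y w)) := by
  calc m x (m y (m z w)) = m (m (m z y) x) w := by rw [A5 y z w, A5 x (m z y) w]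
    _ = m (m y (m z x)) w := by rw [A5 y z x]
    _ = m x (m z (m y w)) := by rw [← A5 (m z x) y w, ← A5 x z (m y w)]

/-- Multiplying by `x` amounts to multiplying by the two factors of `x` given by (J5'). -/
theorem split_meet (A5 : ∀ x y z, m x (m y z) = m (m y x) z)
    (hJ : ∀ x y, x = m (c (m (c x) y)) (c (m (c x) (c y)))) (x y z : B) :
    m (c (m (c x) (c y))) (m (c (m (c x) y)) z) = m x z := by
  rw [A5, ← hJ x y]

/-- The second factor of `x` in (J5') commutes with `x`. -/
theorem split_right_comm (A5 : ∀ x y z, m x (m y z) = m (m y x) z)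
    (hJ : ∀ x y, x = m (c (m (c x) y)) (c (m (c x) (c y)))) (x y : B) :
    m (c (m (c x) (c y))) x = m x (c (m (c x) (c y))) := by
  have h := split_meet A5 hJ x y (c (m (c x) (c y)))
  rwa [← hJ x y] at h

theorem meet_compl_self (A5 : ∀ x y z, m x (m y z) = m (m y x) z)
    (hJ : ∀ x y, x = m (c (m (c x) y)) (c (m (c x) (c y)))) (x y : B) :
    m x (m (c y) (c y)) = m (c y) (m (c y) x) := by
  have h := split_right_comm A5 hJ (m (c y) x) (m (c y) (c x))
  rw [← hJ y x] at h
  rw [A5, ← h]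

/-- The first factor of `x` in (J5') commutes with `x`. -/
theorem split_left_comm (A5 : ∀ x y z, m x (m y z) = m (m y x) z)
    (hJ : ∀ x y, x = m (c (m (c x) y)) (c (m (c x) (c y)))) (x y : B) :
    m (c (m (c x) y)) x = m x (c (m (c x) y)) := by
  calc m (c (m (c x) y)) x
      = m (c (m (c x) y)) (m (c (m (c x) y)) (c (m (c x) (c y)))) := by rw [← hJ x y]
    _ = m (c (m (c x) (c y))) (m (c (m (c x) y)) (c (m (c x) y))) :=
      (meet_compl_self A5 hJ _ _).symm
    _ = m x (c (m (c x) y)) := split_meet A5 hJ x y _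

theorem compl_meet_compl_left (A5 : ∀ x y z, m x (m y z) = m (m y x) z)
    (hJ : ∀ x y, x = m (c (m (c x) y)) (c (m (c x) (c y)))) (x y z : B) :
    m (c x) (m (c y) (c (m y z))) = m (c (m y z)) (m (c y) (c x)) := by
  have h := split_left_comm A5 hJ (m (c y) (c x)) (m (c (m (c y) x)) z)
  rw [split_meet A5 hJ y x z] at h
  rw [A5, h]

theorem compl_meet_comm (A5 : ∀ x y z, m x (m y z) = m (m y x) z)
    (hJ : ∀ x y, x = m (c (m (c x) y)) (c (m (c x) (c y)))) (x y z : B) :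
    m (c (m x (m (c y) z))) y = m y (c (m x (m (c y) z))) := by
  calc m (c (m x (m (c y) z))) y
      = m (c (m (m (c y) x) z)) (m (c (m (c y) x)) (c (m (c y) (c x)))) := by
        rw [← hJ y x, A5 x (c y) z]
    _ = m (c (m (c y) (c x))) (m (c (m (c y) x)) (c (m (m (c y) x) z))) :=
      (compl_meet_compl_left A5 hJ _ _ _).symm
    _ = m y (c (m x (m (c y) z))) := by rw [split_meet A5 hJ, A5 x (c y) z]

theorem compl_meet_compl_right (A5 : ∀ x y z, m x (m y z) = m (m y x) z)
    (hJ : ∀ x y, x = m (c (m (c x) y)) (c (m (c x) (c y)))) (x y z : B) :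
    m x (m (c y) (c (m z y))) = m (c (m z y)) (m (c y) x) := by
  have h := compl_meet_comm A5 hJ z (m (c y) x) (c (m (c y) (c x)))
  rw [← hJ y x] at h
  rw [A5, h]

theorem meet_compl_rotate (A5 : ∀ x y z, m x (m y z) = m (m y x) z)
    (hJ : ∀ x y, x = m (c (m (c x) y)) (c (m (c x) (c y)))) (x y z w : B) :
    m x (m (c y) (m (c (m z y)) w)) = m w (m x (m (c y) (c (m z y)))) := by
  calc m x (m (c y) (m (c (m z y)) w))
      = m (m (c (m z y)) (m (c y) x)) w := by
        rw [A5 x (c y) (m (c (m z y)) w), A5 (m (c y) x) (c (m z y)) w]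
    _ = m (m x (m (c y) (c (m z y)))) w := by rw [compl_meet_compl_right A5 hJ x y z]
    _ = m (c (m z y)) (m (c y) (m x w)) := by
        rw [← A5 (m (c y) (c (m z y))) x w, ← A5 (c (m z y)) (c y) (m x w)]
    _ = m (m x w) (m (c y) (c (m z y))) := (compl_meet_compl_right A5 hJ _ y z).symm
    _ = m w (m x (m (c y) (c (m z y)))) := (A5 _ _ _).symm

theorem meet_compl_swap (A5 : ∀ x y z, m x (m y z) = m (m y x) z)
    (hJ : ∀ x y, x = m (c (m (c x) y)) (c (m (c x) (c y)))) (x y z : B) :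
    m x (m (c y) z) = m z (m (c y) x) := by
  calc m x (m (c y) z)
      = m (c (m (c x) (c y))) (m (c y) (m (c (m (c x) y)) z)) := by
        rw [meet_left_comm_of_A5 A5, split_meet A5 hJ]
    _ = m z (m (c (m (c x) (c y))) (m (c y) (c (m (c x) y)))) := meet_compl_rotate A5 hJ _ _ _ _
    _ = m z (m (c (m (c x) y)) (m (c y) (c (m (c x) (c y))))) := by
        rw [compl_meet_compl_right A5 hJ]
    _ = m z (m (c y) (m (c (m (c x) y)) (c (m (c x) (c y))))) := meet_left_comm_of_A5 A5 _ _ _ _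
    _ = m z (m (c y) x) := by rw [← hJ x y]

/-- (A5) and (J5') imply that the binary operation is commutative. -/
theorem meet_comm_of_A5_split (A5 : ∀ x y z, m x (m y z) = m (m y x) z)
    (hJ : ∀ x y, x = m (c (m (c x) y)) (c (m (c x) (c y)))) (x y : B) :
    m x y = m y x := by
  rw [← split_meet A5 hJ x x y, meet_compl_swap A5 hJ, ← hJ x x]

end MeetComplement

/-- Under (A5) and (J5'): x ∧ (y ∧ u) = x ∧ (u ∧ y). -/
theorem A5_J5'_lemma811 {B : Type*} (m : B → B → B) (c : B → B)
    (A5 : ∀ x y z, m x (m y z) = m (m y x) z)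
    (J5' : ∀ x y, x = m (c (m (c x) y)) (c (m (c x) (c y)))) :
    ∀ x y u, m x (m y u) = m x (m u y) := by
  intro x y u
  rw [meet_comm_of_A5_split A5 J5' y u]
end

section
/- The identities (A9), (J4), (J5) form a 3-base for Boolean algebras: if a nonempty type B equipped with a binary operation ∧ and a unary operation ' satisfies (A9) x ∧ (y ∧ z) = z ∧ (y ∧ x), (J4) x'' = x, and (J5) x' = (x ∧ y)' ∧ (x ∧ y')' for all x, y, z ∈ B, then there exists a Boolean algebra structure on B whose infimum operation is ∧ and whose complement operation is '. -/
section

variable {B : Type*} {m : B → B → B} {c : B → B}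

/-- The identities (A9), (J4), (J5) imply commutativity. -/
theorem comm_of_A9_J4_J5
    (A9 : ∀ x y z, m x (m y z) = m z (m y x))
    (J4 : ∀ x, c (c x) = x)
    (J5 : ∀ x y, c x = m (c (m x y)) (c (m x (c y)))) (x y : B) : m x y = m y x := by
  have J5_swap (x y : B) : m (c (m x (c y))) (c (m x y)) = c x := by
    simpa only [J4] using (J5 x (c y)).symm
  have absorb (x y z : B) : m (c (m x (c y))) (m (c (m x y)) z) = m z (c x) := by
    rw [A9, ← J5]
  have mul_compl (x y z : B) : m (m (c (m x y)) z) (c x) = m (c x) (m z (c (m x y))) := by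
    have h := absorb x (c y) (m (c (m x y)) z)
    rw [absorb x y z, J4] at h
    rw [← h, A9]
  have compl_comm (x y : B) : m (c x) (c y) = m (c y) (c x) := by
    have h₁ : m (c (m y (m x x))) (c (m x (c (m x y)))) = c x := by
      rw [A9 y x x, ← J5]
    have h₂ : m (c (m x (c (m x y)))) (c (m y (m x x))) = c x := by
      rw [A9 y x x, J5_swap]
    have h := mul_compl y (m x x) (c (m x (c (m x y))))
    rwa [h₁, h₂] at h
  simpa only [J4] using compl_comm (c x) (c y)

/-- Huntington's theorem, in its meet form: a commutative semigroup with an involution satisfying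
`x' = (x ∧ y)' ∧ (x ∧ y')'` is a Boolean algebra. -/
theorem exists_booleanAlgebra_of_huntington [Nonempty B]
    (comm : ∀ x y, m x y = m y x)
    (assoc : ∀ x y z, m (m x y) z = m x (m y z))
    (invol : ∀ x, c (c x) = x)
    (huntington : ∀ x y, c x = m (c (m x y)) (c (m x (c y)))) :
    ∃ ba : BooleanAlgebra B, ba.inf = m ∧ ba.compl = c := by
  have : Std.Commutative m := ⟨comm⟩
  have : Std.Associative m := ⟨assoc⟩
  obtain ⟨e⟩ := ‹Nonempty B›
  obtain ⟨o, ho⟩ : ∃ o, ∀ x, m x (c x) = o := by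
    refine ⟨m e (c e), fun x ↦ ?_⟩
    have expand (x y : B) : m x (c x) =
        m (m (c (m (c x) y)) (c (m (c x) (c y)))) (m (c (m x y)) (c (m x (c y)))) := by
      rw [← huntington, ← huntington, invol]
    rw [expand x e, expand e x, comm (c e) x, comm e x, comm e (c x), comm (c e) (c x)]
    ac_rfl
  have compl_eq (x : B) : c x = m (c (m x x)) (c o) := by
    rw [← ho x, ← huntington]
  have one_mul_one : m (c o) (c o) = c o := by
    have h₀ : m (c (m (c o) (c o))) (c o) = o := by rw [← compl_eq, invol]
    have h₁ : m (c (m (c o) (c o))) o = m o o := by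
      calc m (c (m (c o) (c o))) o
          = m (c (m (c o) (c o))) (m (c o) (c (c o))) := by rw [ho]
        _ = m o o := by rw [← assoc, h₀, invol]
    have h₂ := huntington (c (m (c o) (c o))) o
    rwa [h₀, h₁, invol, ← compl_eq] at h₂
  have mul_one (x : B) : m x (c o) = x := by
    rw [← invol x, compl_eq (c x), assoc, one_mul_one]
  have idem (x : B) : m x x = x := by
    rw [← invol (m x x), ← mul_one (c (m x x)), ← compl_eq, invol]
  have mul_zero (x : B) : m x o = o := by
    rw [← ho x, ← assoc, idem]
  have le_of_mul_compl {x y : B} (h : m x (c y) = o) : m x y = x := by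
    have h' := huntington x y
    rw [h, mul_one] at h'
    rw [← invol (m x y), ← h', invol]
  have compl_anti {x y : B} (h : m x y = x) : m (c y) (c x) = c y := by
    apply le_of_mul_compl
    rw [invol, ← h, comm x y, ← assoc, comm (c y), ho, comm, mul_zero]
  have le_trans' {x y z : B} (h₁ : m x y = x) (h₂ : m y z = y) : m x z = x := by
    rw [← h₁, assoc, h₂]
  have mul_le_left (x y : B) : m (m x y) x = m x y := by
    rw [comm, ← assoc, idem]
  have mul_le_right (x y : B) : m (m x y) y = m x y := by
    rw [assoc, idem]
  have le_mul {x y z : B} (h₁ : m x y = x) (h₂ : m x z = x) : m x (m y z) = x := by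
    rw [← assoc, h₁, h₂]
  let lattice : Lattice B :=
    { le x y := m x y = x
      le_refl := idem
      le_trans _ _ _ := le_trans'
      le_antisymm x y h₁ h₂ := by rw [← h₁, comm, h₂]
      inf := m
      inf_le_left := mul_le_left
      inf_le_right := mul_le_right
      le_inf _ _ _ := le_mul
      sup x y := c (m (c x) (c y))
      le_sup_left x y := by
        simpa only [invol] using compl_anti (mul_le_left (c x) (c y))
      le_sup_right x y := by
        simpa only [invol] using compl_anti (mul_le_right (c x) (c y))
      sup_le x y z h₁ h₂ := by
        simpa only [invol] using compl_anti (le_mul (compl_anti h₁) (compl_anti h₂)) }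
  let distrib : DistribLattice B := DistribLattice.ofInfSupLe fun x y z ↦ by
    change m (m x (c (m (c y) (c z)))) (c (m (c (m x y)) (c (m x z)))) =
      m x (c (m (c y) (c z)))
    apply le_of_mul_compl
    rw [invol]
    set w := m (m x (c (m (c y) (c z)))) (m (c (m x y)) (c (m x z))) with hw
    have hy : m w (c y) = w := by
      apply le_of_mul_compl
      calc m w (c (c y))
          = m (m (c (m (c y) (c z))) (c (m x z))) (m (m x y) (c (m x y))) := by
            rw [invol, hw]; ac_rfl
        _ = o := by rw [ho, mul_zero]
    have hz : m w (c z) = w := by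
      apply le_of_mul_compl
      calc m w (c (c z))
          = m (m (c (m (c y) (c z))) (c (m x y))) (m (m x z) (c (m x z))) := by
            rw [invol, hw]; ac_rfl
        _ = o := by rw [ho, mul_zero]
    calc w = m w (m (c y) (c z)) := (le_mul hy hz).symm
      _ = m (m x (m (c (m x y)) (c (m x z))))
          (m (m (c y) (c z)) (c (m (c y) (c z)))) := by rw [hw]; ac_rfl
      _ = o := by rw [ho, mul_zero]
  exact ⟨{ distrib with
    compl := c
    sdiff := fun x y ↦ m x (c y)
    himp := fun x y ↦ c (m (c y) (c (c x)))
    sdiff_eq := fun _ _ ↦ rfl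
    himp_eq := fun _ _ ↦ rfl
    bot := o
    top := c o
    bot_le := fun x ↦ show m o x = o by rw [comm, mul_zero]
    le_top := mul_one
    inf_compl_le_bot := fun x ↦ show m (m x (c x)) o = m x (c x) by rw [mul_zero, ho]
    top_le_sup_compl := fun x ↦ show m (c o) (c (m (c x) (c (c x)))) = c o by
      rw [ho, idem] }, rfl, rfl⟩

end

/-- (A9), (J4), (J5) form a 3-base for Boolean algebras. -/
theorem A9_J4_J5_base {B : Type*} [Nonempty B] (m : B → B → B) (c : B → B)
    (A9 : ∀ x y z, m x (m y z) = m z (m y x))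
    (J4 : ∀ x, c (c x) = x)
    (J5 : ∀ x y, c x = m (c (m x y)) (c (m x (c y)))) :
    ∃ ba : BooleanAlgebra B, ba.inf = m ∧ ba.compl = c := by
  have comm := comm_of_A9_J4_J5 A9 J4 J5
  refine exists_booleanAlgebra_of_huntington comm (fun x y z ↦ ?_) J4 J5
  rw [comm (m x y) z, comm x y, A9]
end

section
/- Assume a type B with binary operation ∧ and unary operation ' satisfies (A9) x ∧ (y ∧ z) = z ∧ (y ∧ x), (J4) x'' = x, and (J5) x' = (x ∧ y)' ∧ (x ∧ y')' for all x, y, z. Then the commutative law x ∧ y = y ∧ x holds for all x, y ∈ B. -/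
/-- Under (A9), (J4), (J5) the commutative law holds. -/
theorem A9_J4_J5_comm {B : Type*} (m : B → B → B) (c : B → B)
    (A9 : ∀ x y z, m x (m y z) = m z (m y x))
    (J4 : ∀ x, c (c x) = x)
    (J5 : ∀ x y, c x = m (c (m x y)) (c (m x (c y)))) :
    ∀ x y, m x y = m y x := by
  have J5_swap (x y : B) : c x = m (c (m x (c y))) (c (m x y)) := by
    simpa only [J4] using J5 x (c y)
  have mul_compl (x y z : B) : m x (c y) = m (c (m y z)) (m (c (m y (c z))) x) :=
    calc m x (c y)
      _ = m x (m (c (m y (c z))) (c (m y z))) := congrArg (m x) (J5_swap y z)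
      _ = m (c (m y z)) (m (c (m y (c z))) x) := A9 _ _ _
  have compl_mul (x y z : B) : m (c x) (m y (c (m x z))) = m (m (c (m x z)) y) (c x) :=
    calc m (c x) (m y (c (m x z)))
      _ = m (c (m x z)) (m y (c x)) := A9 _ _ _
      _ = m (c (m x z)) (m (c (m x (c z))) (m (c (m x z)) y)) := by
        rw [mul_compl y x (c z), J4]
      _ = m (m (c (m x z)) y) (c x) := (mul_compl _ x z).symm
  have compl_comm (x y : B) : m (c x) (c y) = m (c y) (c x) :=
    calc m (c x) (c y)
      _ = m (m (c (m y (m x x))) (c (m x (c (m x y))))) (c y) := by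
        rw [A9 y x x, ← J5 x (m x y)]
      _ = m (c y) (m (c (m x (c (m x y)))) (c (m y (m x x)))) := (compl_mul y _ _).symm
      _ = m (c y) (c x) := by rw [A9 y x x, ← J5_swap x (m x y)]
  intro x y
  simpa only [J4] using compl_comm (c x) (c y)
end
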